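/- Let Λ = {λ₁, z₁, z̄₁, …, z_m, z̄_m} with λ₁ > 0, z_j = a_j + i b_j, b_j > 0 for all j, and m odd. Then Λ cannot be the spectrum of a (2m+1)×(2m+1) centrosymmetric nonnegative matrix. -/

import Mathlib

open Matrix Polynomial

/-- The n×n exchange (counteridentity) matrix. -/
def Jmat (n : ℕ) : Matrix (Fin n) (Fin n) ℝ :=
  Matrix.of fun i j => if (i : ℕ) + (j : ℕ) = n - 1 then 1 else 0

/-- A weakly diagonally dominant system with nonnegative right-hand side has a nonnegative
solution. -/
lemma nonneg_of_mulVec_le_smul {n : Type*} [Fintype n] {T : Matrix n n ℝ} {c : ℝ} {v : n → ℝ}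
    (hT : ∀ i j, 0 ≤ T i j) (hc : ∀ i, ∑ j, T i j < c)
    (hv : ∀ i, ∑ j, T i j * v j ≤ c * v i) (i : n) : 0 ≤ v i := by
  obtain ⟨k, -, hk⟩ := Finset.exists_min_image Finset.univ v ⟨i, Finset.mem_univ i⟩
  refine le_trans ?_ (hk i (Finset.mem_univ i))
  by_contra! hneg
  have h1 : (∑ j, T k j) * v k ≤ ∑ j, T k j * v j := by
    rw [Finset.sum_mul]
    exact Finset.sum_le_sum fun j _ => mul_le_mul_of_nonneg_left (hk j (Finset.mem_univ j)) (hT k j)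
  nlinarith [hv k, hc k]

/-- A weak form of the Perron theorem: a nonnegative matrix has a real eigenvalue that is at least
as large as any given diagonal entry. -/
lemma exists_det_smul_one_sub_eq_zero {n : Type*} [Fintype n] [DecidableEq n] {A : Matrix n n ℝ}
    (hA : ∀ i j, 0 ≤ A i j) (i : n) : ∃ μ, A i i ≤ μ ∧ (μ • (1 : Matrix n n ℝ) - A).det = 0 := by
  by_contra! h
  set R : ℝ → Matrix n n ℝ := fun x => (x • (1 : Matrix n n ℝ) - A)⁻¹ with hR
  have hmul (x : ℝ) (hx : A i i ≤ x) : (x • (1 : Matrix n n ℝ) - A) * R x = 1 :=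
    Matrix.mul_nonsing_inv _ (h x hx).isUnit
  have hmul' (x : ℝ) (hx : A i i ≤ x) : R x * (x • (1 : Matrix n n ℝ) - A) = 1 :=
    Matrix.nonsing_inv_mul _ (h x hx).isUnit
  have hentry (x : ℝ) (hx : A i i ≤ x) (k l : n) :
      x * R x k l - ∑ j, A k j * R x j l = (1 : Matrix n n ℝ) k l := by
    rw [← hmul x hx, sub_mul, smul_mul_assoc, one_mul, Matrix.sub_apply, Matrix.smul_apply,
      mul_apply, smul_eq_mul]
  have hone (k l : n) : 0 ≤ (1 : Matrix n n ℝ) k l := by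
    rw [one_apply]; split_ifs <;> norm_num
  have hrow (B : Matrix n n ℝ) (hB : ∀ i j, 0 ≤ B i j) (k : n) :
      ∑ j, B k j ≤ ∑ k, ∑ j, B k j :=
    Finset.single_le_sum (f := fun k => ∑ j, B k j)
      (fun k _ => Finset.sum_nonneg fun j _ => hB k j) (Finset.mem_univ k)
  set K := A i i + 1 + ∑ k, ∑ j, A k j with hK
  have hsum : 0 ≤ ∑ k, ∑ j, A k j :=
    Finset.sum_nonneg fun k _ => Finset.sum_nonneg fun j _ => hA k j
  have hstart (k l : n) : 0 ≤ R K k l := by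
    refine nonneg_of_mulVec_le_smul (T := A) (c := K) (v := fun k => R K k l) hA
      (fun k => ?_) (fun k => ?_) k
    · linarith [hrow A hA k, hA i i]
    · linarith [hentry K (by linarith) k l, hone k l]
  have hstep (x y : ℝ) (hy : A i i ≤ y) (hyx : y ≤ x) (hx : ∀ k l, 0 ≤ R x k l)
      (hd : (x - y) * ∑ k, ∑ j, R x k j < 1) (k l : n) : 0 ≤ R y k l := by
    have key : R y - (x - y) • (R x * R y) = R x := by
      have h1 : R x * ((y • (1 : Matrix n n ℝ) - A) * R y) = R x := by rw [hmul y hy, mul_one]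
      have h2 : (y • (1 : Matrix n n ℝ) - A) = (x • (1 : Matrix n n ℝ) - A) - (x - y) • 1 := by
        rw [sub_smul]; abel
      rw [h2, ← mul_assoc, mul_sub, hmul' x (hy.trans hyx), sub_mul, one_mul] at h1
      simpa using h1
    refine nonneg_of_mulVec_le_smul (T := (x - y) • R x) (c := 1) (v := fun k => R y k l)
      (fun k l => mul_nonneg (sub_nonneg.2 hyx) (hx k l)) (fun k => ?_) (fun k => ?_) k
    · simp only [Matrix.smul_apply, smul_eq_mul, ← Finset.mul_sum]
      exact (mul_le_mul_of_nonneg_left (hrow _ hx k) (sub_nonneg.2 hyx)).trans_lt hd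
    · have := congrFun (congrFun key k) l
      simp only [Matrix.sub_apply, Matrix.smul_apply, mul_apply, smul_eq_mul] at this ⊢
      simp only [mul_assoc, ← Finset.mul_sum]
      linarith [hx k l]
  have hcont (k l : n) : ContinuousOn (fun s => R (K - s) k l) (Set.Icc 0 (K - A i i)) := by
    have hpoly : Continuous fun s : ℝ => (K - s) • (1 : Matrix n n ℝ) - A := by fun_prop
    simp only [hR, inv_def, Matrix.smul_apply, Ring.inverse_eq_inv', smul_eq_mul]
    exact (hpoly.matrix_det.continuousOn.inv₀ fun s hs => h _ (by linarith [hs.2])).mul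
      (hpoly.matrix_adjugate.matrix_elem k l).continuousOn
  have hclosed : IsClosed ({s | ∀ k l, 0 ≤ R (K - s) k l} ∩ Set.Icc 0 (K - A i i)) := by
    have : {s | ∀ k l, 0 ≤ R (K - s) k l} ∩ Set.Icc 0 (K - A i i) =
        Set.Icc 0 (K - A i i) ∩ (fun s k l => R (K - s) k l) ⁻¹' Set.Ici (0 : n → n → ℝ) := by
      ext s
      simp [Pi.le_def, and_comm]
    rw [this]
    exact (continuousOn_pi.2 fun k => continuousOn_pi.2 (hcont k)).preimage_isClosed_of_isClosed
      isClosed_Icc isClosed_Ici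
  have hsub := hclosed.Icc_subset_of_forall_exists_gt (by simpa using hstart) ?_
  · have hfin : ∀ k l, 0 ≤ R (K - (K - A i i)) k l := hsub ⟨by linarith, le_rfl⟩
    rw [sub_sub_cancel] at hfin
    have h1 := hentry (A i i) le_rfl i i
    have h2 : A i i * R (A i i) i i ≤ ∑ j, A i j * R (A i i) j i :=
      Finset.single_le_sum (f := fun j => A i j * R (A i i) j i)
        (fun j _ => mul_nonneg (hA i j) (hfin j i)) (Finset.mem_univ i)
    rw [one_apply_eq] at h1
    linarith
  · rintro s ⟨hs, hs0, hs1⟩ t (ht : s < t)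
    set r := ∑ k, ∑ j, R (K - s) k j
    have hr : 0 ≤ r := Finset.sum_nonneg fun k _ => Finset.sum_nonneg fun j _ => hs k j
    set d := min (min (t - s) (K - A i i - s)) (1 / (r + 1)) with hd
    have hd0 : 0 < d := lt_min (lt_min (by linarith) (by linarith)) (by positivity)
    have hd1 : d ≤ t - s := (min_le_left _ _).trans (min_le_left _ _)
    have hd2 : d ≤ K - A i i - s := (min_le_left _ _).trans (min_le_right _ _)
    have hd3 : d * (r + 1) ≤ 1 := (le_div_iff₀ (by positivity)).1 (min_le_right _ _)
    refine ⟨s + d, hstep (K - s) _ (by linarith) (by linarith) hs ?_, by linarith, by linarith⟩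
    have : K - s - (K - (s + d)) = d := by ring
    rw [this]
    linarith

lemma exists_isRoot_of_monic_of_odd_natDegree {p : ℝ[X]} (hp : p.Monic) (hodd : Odd p.natDegree) :
    ∃ x, p.IsRoot x := by
  have hdeg : 0 < p.degree := natDegree_pos_iff_degree_pos.1 hodd.pos
  have htop := p.tendsto_atTop_of_leadingCoeff_nonneg hdeg (by simp [hp.leadingCoeff])
  have hnat : (p.comp (-X)).natDegree = p.natDegree := by simp [natDegree_comp]
  have hbot := (p.comp (-X)).tendsto_atBot_of_leadingCoeff_nonpos
    (natDegree_pos_iff_degree_pos.1 (hnat ▸ hodd.pos))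
    (by rw [leadingCoeff_comp (by simp)]; simp [hp.leadingCoeff, hodd.neg_one_pow])
  obtain ⟨x, hx⟩ := (hbot.eventually_le_atBot 0).exists
  obtain ⟨y, hy⟩ := (htop.eventually_ge_atTop 0).exists
  rw [eval_comp] at hx
  exact mem_range_of_exists_le_of_exists_ge p.continuous ⟨_, hx⟩ ⟨y, hy⟩

/-- An endomorphism of an odd-dimensional real vector space has a real eigenvalue. -/
lemma exists_hasEigenvalue_of_odd_finrank {V : Type*} [AddCommGroup V] [Module ℝ V]
    [FiniteDimensional ℝ V] (hV : Odd (Module.finrank ℝ V)) (f : Module.End ℝ V) :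
    ∃ μ, f.HasEigenvalue μ := by
  obtain ⟨μ, hμ⟩ := exists_isRoot_of_monic_of_odd_natDegree f.charpoly_monic
    (by rwa [LinearMap.charpoly_natDegree])
  exact ⟨μ, (Module.End.hasEigenvalue_iff_isRoot_charpoly f μ).2 hμ⟩

lemma Jmat_apply_eq_ite_rev (m : ℕ) (i j : Fin (2 * m + 1)) :
    Jmat (2 * m + 1) i j = if j = i.rev then 1 else 0 := by
  simp only [Jmat, of_apply, Fin.ext_iff, Fin.val_rev]
  congr 1
  exact propext (by omega)

lemma Jmat_mul_self (m : ℕ) : Jmat (2 * m + 1) * Jmat (2 * m + 1) = 1 := by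
  ext i j
  have hrev (k : Fin (2 * m + 1)) : j = k.rev ↔ k = j.rev := by
    rw [← Fin.rev_eq_iff, eq_comm]
  simp [mul_apply, Jmat_apply_eq_ite_rev, one_apply, hrev, @eq_comm _ i j]

lemma trace_Jmat (m : ℕ) : (Jmat (2 * m + 1)).trace = 1 := by
  obtain ⟨c, hc⟩ : ∃ c : Fin (2 * m + 1), (c : ℕ) = m := ⟨⟨m, by omega⟩, rfl⟩
  have (i : Fin (2 * m + 1)) : i = i.rev ↔ i = c := by
    rw [Fin.ext_iff, Fin.ext_iff, Fin.val_rev, hc]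
    omega
  simp [trace, Jmat_apply_eq_ite_rev, this]

lemma finrank_ker_one_add_Jmat (m : ℕ) :
    Module.finrank ℝ (LinearMap.ker (toLin' (1 + Jmat (2 * m + 1)))) = m := by
  set J := Jmat (2 * m + 1)
  have hJJ : J * J = 1 := Jmat_mul_self m
  have hproj : LinearMap.IsProj (LinearMap.ker (toLin' (1 + J)))
      (toLin' ((1 / 2 : ℝ) • (1 - J))) := by
    constructor
    · intro v
      have : (1 + J) * ((1 / 2 : ℝ) • (1 - J)) = 0 := by
        rw [mul_smul_comm, mul_sub, add_mul, add_mul, hJJ]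
        simp [add_comm]
      rw [LinearMap.mem_ker, ← LinearMap.comp_apply, ← toLin'_mul, this]
      simp
    · intro v hv
      have hv' : v + J *ᵥ v = 0 := by simpa [add_mulVec] using hv
      rw [toLin'_apply, smul_mulVec, sub_mulVec, one_mulVec, eq_neg_of_add_eq_zero_right hv']
      ext k
      simp
      ring
  have htr := hproj.trace
  rw [trace_toLin'_eq, trace_smul, trace_sub, trace_Jmat, trace_one] at htr
  simp at htr
  exact_mod_cast htr.symm

section Centrosymmetric

variable {m : ℕ} {M : Matrix (Fin (2 * m + 1)) (Fin (2 * m + 1)) ℝ}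

lemma commute_Jmat_of_centrosymmetric (hM : Jmat (2 * m + 1) * M * Jmat (2 * m + 1) = M) :
    Jmat (2 * m + 1) * M = M * Jmat (2 * m + 1) := by
  nth_rw 2 [← hM]
  rw [mul_assoc, Jmat_mul_self, mul_one]

lemma exists_skew_eigenvector (hm : Odd m) (hM : Jmat (2 * m + 1) * M = M * Jmat (2 * m + 1)) :
    ∃ (μ : ℝ) (v : Fin (2 * m + 1) → ℝ), v ≠ 0 ∧ Jmat (2 * m + 1) *ᵥ v = -v ∧ M *ᵥ v = μ • v := by
  have hmaps : ∀ v ∈ LinearMap.ker (toLin' (1 + Jmat (2 * m + 1))),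
      toLin' M v ∈ LinearMap.ker (toLin' (1 + Jmat (2 * m + 1))) := by
    intro v hv
    rw [LinearMap.mem_ker, toLin'_apply] at hv ⊢
    rw [toLin'_apply, mulVec_mulVec, add_mul, hM, one_mul]
    nth_rw 1 [← mul_one M]
    rw [← mul_add, ← mulVec_mulVec, hv, mulVec_zero]
  obtain ⟨μ, hμ⟩ := exists_hasEigenvalue_of_odd_finrank
    (by rwa [finrank_ker_one_add_Jmat]) ((toLin' M).restrict hmaps)
  obtain ⟨v, hv⟩ := hμ.exists_hasEigenvector
  refine ⟨μ, v, fun h => hv.2 (Subtype.ext h), ?_, ?_⟩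
  · have := v.2
    rw [LinearMap.mem_ker, toLin'_apply, add_mulVec, one_mulVec] at this
    exact eq_neg_of_add_eq_zero_right this
  · simpa using congrArg Subtype.val hv.apply_eq_smul

lemma exists_symmetric_eigenvector (hM : Jmat (2 * m + 1) * M = M * Jmat (2 * m + 1))
    (hnonneg : ∀ i j, 0 ≤ M i j) :
    ∃ (μ : ℝ) (v : Fin (2 * m + 1) → ℝ), v ≠ 0 ∧ Jmat (2 * m + 1) *ᵥ v = v ∧ M *ᵥ v = μ • v := by
  set J := Jmat (2 * m + 1)
  have hJJ : J * J = 1 := Jmat_mul_self m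
  have hJ (i j) : 0 ≤ J i j := by
    simp only [J, Jmat_apply_eq_ite_rev]; split_ifs <;> norm_num
  have hone (i j) : 0 ≤ (1 : Matrix (Fin (2 * m + 1)) (Fin (2 * m + 1)) ℝ) i j := by
    rw [one_apply]; split_ifs <;> norm_num
  have hl (i j) : 0 ≤ (M + 1) i j := add_nonneg (hnonneg i j) (hone i j)
  have hr (i j) : 0 ≤ (1 + J) i j := add_nonneg (hone i j) (hJ i j)
  obtain ⟨μ, hμ, hdet⟩ := exists_det_smul_one_sub_eq_zero (A := (M + 1) * (1 + J))
    (fun i j => by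
      rw [mul_apply]; exact Finset.sum_nonneg fun k _ => mul_nonneg (hl i k) (hr k j)) 0
  have hμ0 : 0 < μ := by
    refine lt_of_lt_of_le ?_ hμ
    refine lt_of_lt_of_le ?_ (Finset.single_le_sum (f := fun k => (M + 1) 0 k * (1 + J) k 0)
      (fun k _ => mul_nonneg (hl 0 k) (hr k 0)) (Finset.mem_univ 0))
    simp only [Matrix.add_apply, one_apply_eq]
    have := hnonneg 0 0
    have := hJ 0 0
    positivity
  obtain ⟨v, hv0, hv⟩ := exists_mulVec_eq_zero_iff.2 hdet
  rw [sub_mulVec, smul_mulVec, one_mulVec, sub_eq_zero] at hv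
  have hJv : J *ᵥ v = v := by
    have hcomm : J * ((M + 1) * (1 + J)) = (M + 1) * (1 + J) := by
      have hJM : J * (M + 1) = (M + 1) * J := by rw [mul_add, hM, mul_one, add_one_mul]
      rw [← mul_assoc, hJM, mul_assoc, mul_add J, hJJ, mul_one, add_comm J]
    apply smul_right_injective _ hμ0.ne'
    simp only
    rw [← mulVec_smul, hv, mulVec_mulVec, hcomm]
  refine ⟨μ / 2 - 1, v, hv0, hJv, ?_⟩
  rw [← mulVec_mulVec, add_mulVec, add_mulVec, one_mulVec, one_mulVec, hJv, mulVec_add] at hv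
  ext k
  have := congrFun hv k
  simp only [Pi.smul_apply, Pi.add_apply, smul_eq_mul] at this ⊢
  linarith

/-- A nonnegative centrosymmetric matrix of order `2 * m + 1`, with `m` odd, whose only real
eigenvalue is `r` has `r` as an eigenvalue of multiplicity at least two. -/
lemma two_le_rootMultiplicity_charpoly (hm : Odd m)
    (hM : Jmat (2 * m + 1) * M * Jmat (2 * m + 1) = M) (hnonneg : ∀ i j, 0 ≤ M i j) {r : ℝ}
    (hr : ∀ μ, M.charpoly.IsRoot μ → μ = r) : 2 ≤ M.charpoly.rootMultiplicity r := by
  have hcomm := commute_Jmat_of_centrosymmetric hM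
  have heig (μ : ℝ) (v : Fin (2 * m + 1) → ℝ) (hv : v ≠ 0) (h : M *ᵥ v = μ • v) :
      v ∈ Module.End.eigenspace (toLin' M) r := by
    have hmem : v ∈ Module.End.eigenspace (toLin' M) μ :=
      Module.End.mem_eigenspace_iff.2 (by simpa using h)
    have hμ := Module.End.hasEigenvalue_of_hasEigenvector ⟨hmem, hv⟩
    rw [Module.End.hasEigenvalue_iff_isRoot_charpoly, charpoly_toLin'] at hμ
    rwa [hr μ hμ] at hmem
  obtain ⟨μ, v, hv0, hJv, hv⟩ := exists_skew_eigenvector hm hcomm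
  obtain ⟨ν, w, hw0, hJw, hw⟩ := exists_symmetric_eigenvector hcomm hnonneg
  have hind : LinearIndependent ℝ ![(⟨v, heig μ v hv0 hv⟩ : Module.End.eigenspace (toLin' M) r),
      ⟨w, heig ν w hw0 hw⟩] := by
    rw [LinearIndependent.pair_iff]
    intro s t hst
    have hst1 : s • v + t • w = 0 := congrArg Subtype.val hst
    have hst2 : -(s • v) + t • w = 0 := by
      simpa [mulVec_add, mulVec_smul, hJv, hJw] using congrArg (Jmat (2 * m + 1) *ᵥ ·) hst1
    have htw : (2 * t) • w = 0 := by
      rw [mul_smul, two_smul]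
      calc t • w + t • w = (s • v + t • w) + (-(s • v) + t • w) := by abel
        _ = 0 := by rw [hst1, hst2, add_zero]
    have ht : t = 0 := by simpa [hw0] using htw
    exact ⟨by simpa [ht, hv0] using hst1, ht⟩
  have h2 := hind.fintype_card_le_finrank
  have hle := LinearMap.finrank_eigenspace_le (toLin' M) r
  rw [charpoly_toLin'] at hle
  simpa using h2.trans hle

end Centrosymmetric

theorem odd_pairs_not_centrosymmetric_realizable (m : ℕ) (hm : Odd m)
    (lam1 : ℝ) (hlam1 : 0 < lam1) (a b : Fin m → ℝ) (hb : ∀ j, 0 < b j) :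
    ¬ ∃ M : Matrix (Fin (2 * m + 1)) (Fin (2 * m + 1)) ℝ,
        Jmat (2 * m + 1) * M * Jmat (2 * m + 1) = M ∧ (∀ i j, 0 ≤ M i j) ∧
        (M.map Complex.ofReal).charpoly =
          (X - C (lam1 : ℂ)) *
            ∏ j, ((X - C (Complex.ofReal (a j) + Complex.ofReal (b j) * Complex.I)) *
              (X - C (Complex.ofReal (a j) - Complex.ofReal (b j) * Complex.I))) := by
  rintro ⟨M, hM, hnonneg, hchar⟩
  set q : ℂ[X] := ∏ j, ((X - C (Complex.ofReal (a j) + Complex.ofReal (b j) * Complex.I)) *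
    (X - C (Complex.ofReal (a j) - Complex.ofReal (b j) * Complex.I))) with hq
  have hq0 (x : ℝ) : ¬ q.IsRoot (x : ℂ) := by
    rw [IsRoot, hq, eval_prod, Finset.prod_eq_zero_iff]
    rintro ⟨j, -, hj⟩
    rw [eval_mul, mul_eq_zero] at hj
    rcases hj with hj | hj <;>
    · have := congrArg Complex.im hj
      simp [(hb j).ne'] at this
  have hmap : M.charpoly.map Complex.ofRealHom = (X - C (lam1 : ℂ)) * q := by
    rw [← hchar, ← charpoly_map]
    rfl
  have hroot (μ : ℝ) (hμ : M.charpoly.IsRoot μ) : μ = lam1 := by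
    have h := hμ.map (f := Complex.ofRealHom)
    rw [hmap, root_mul] at h
    have h' := h.resolve_right (hq0 μ)
    simpa [sub_eq_zero] using h'
  have hmult := two_le_rootMultiplicity_charpoly hm hM hnonneg hroot
  have hne : (X - C (lam1 : ℂ)) * q ≠ 0 := by
    rw [← hchar]
    exact (charpoly_monic _).ne_zero
  have h1 : rootMultiplicity (lam1 : ℂ) ((X - C (lam1 : ℂ)) * q) = 1 := by
    rw [rootMultiplicity_mul hne, rootMultiplicity_X_sub_C_self,
      rootMultiplicity_eq_zero (hq0 lam1)]
  have h2 := eq_rootMultiplicity_map (p := M.charpoly) (f := Complex.ofRealHom)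
    Complex.ofRealHom.injective lam1
  rw [hmap, Complex.ofRealHom_eq_coe, h1] at h2
  omega
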